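/- arXiv:1504.07265 — 2 statements merged into one kernel-verified Lean document; each statement's English description precedes it below -/
import Mathlib

section
/- For all n ≥ 7, the number of permutations in S_n avoiding the consecutive pattern 1342 is strictly greater than the number avoiding the consecutive pattern 1243. -/
/-- The consecutive pattern `σ ∈ S m` occurs in `π ∈ S n` at (0-indexed) position `i`. -/
def occursAt {m n : ℕ} (σ : Equiv.Perm (Fin m)) (π : Equiv.Perm (Fin n)) (i : ℕ) : Prop :=
  ∃ h : i + m ≤ n, ∀ j k : Fin m,
    σ j < σ k ↔ π ⟨i + j, by have := j.isLt; omega⟩ < π ⟨i + k, by have := k.isLt; omega⟩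

/-- `α n σ`: the number of permutations of length `n` avoiding `σ` as a consecutive pattern. -/
noncomputable def avoiders {m : ℕ} (n : ℕ) (σ : Equiv.Perm (Fin m)) : ℕ :=
  Nat.card {π : Equiv.Perm (Fin n) // ∀ i : ℕ, ¬ occursAt σ π i}

/-- The pattern `1342` (0-indexed values `0 2 3 1`). -/
def p1342 : Equiv.Perm (Fin 4) := ⟨![0, 2, 3, 1], ![0, 3, 1, 2], by decide, by decide⟩

/-- The pattern `1243` (0-indexed values `0 1 3 2`). -/
def p1243 : Equiv.Perm (Fin 4) := ⟨![0, 1, 3, 2], ![0, 1, 3, 2], by decide, by decide⟩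


section CP

def extF {n : ℕ} (f : Fin n → ℕ) : ℕ → ℕ := fun i => if h : i < n then f ⟨i, h⟩ else 0

def permF {n : ℕ} (π : Equiv.Perm (Fin n)) : ℕ → ℕ := extF (fun i => (π i : ℕ))

def OInv (m : ℕ) (A : (ℕ → ℕ) → Prop) : Prop :=
  ∀ f g : ℕ → ℕ, (∀ i < m, ∀ j < m, (f i < f j ↔ g i < g j)) → (A f ↔ A g)

open Classical in
noncomputable def cnt (n : ℕ) (A : (ℕ → ℕ) → Prop) : ℚ :=
  ∑ π : Equiv.Perm (Fin n), if A (permF π) then 1 else 0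

noncomputable def pr (n : ℕ) (A : (ℕ → ℕ) → Prop) : ℚ := cnt n A / (n.factorial : ℚ)

open Classical in
lemma cnt_inj {m : ℕ} {A : (ℕ → ℕ) → Prop} (hA : OInv m A) (f : Fin m → ℕ)
    (hf : Function.Injective f) :
    (∑ g : Equiv.Perm (Fin m), if A (extF (fun i => f (g i))) then (1 : ℚ) else 0) = cnt m A := by
  set s := Tuple.sort f
  have hs : StrictMono (f ∘ s) :=
    (Tuple.monotone_sort f).strictMono_of_injective (hf.comp s.injective)
  unfold cnt
  rw [← Equiv.sum_comp (Equiv.mulLeft s)]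
  refine Finset.sum_congr rfl fun g _ => ?_
  have : A (extF (fun i => f ((Equiv.mulLeft s g) i))) ↔ A (permF g) := by
    apply hA
    intro i hi j hj
    simp only [permF, extF, hi, hj, dif_pos]
    exact hs.lt_iff_lt
  simp only [this]

def blk {m j : ℕ} (g : Equiv.Perm (Fin m)) (h : Equiv.Perm (Fin j)) : Equiv.Perm (Fin (m + j)) :=
  finSumFinEquiv.permCongr (Equiv.sumCongr g h)

lemma blk_left {m j : ℕ} (g : Equiv.Perm (Fin m)) (h : Equiv.Perm (Fin j)) (i : Fin m) :
    blk g h (Fin.castAdd j i) = Fin.castAdd j (g i) := by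
  simp [blk, Equiv.permCongr_apply]

lemma blk_right {m j : ℕ} (g : Equiv.Perm (Fin m)) (h : Equiv.Perm (Fin j)) (i : Fin j) :
    blk g h (Fin.natAdd m i) = Fin.natAdd m (h i) := by
  simp [blk, Equiv.permCongr_apply]

lemma oinv_congr {m : ℕ} {A : (ℕ → ℕ) → Prop} (hA : OInv m A) {f g : ℕ → ℕ}
    (h : ∀ i < m, f i = g i) : A f ↔ A g :=
  hA f g fun i hi j hj => by rw [h i hi, h j hj]

open Classical in
lemma cnt_mul {m j : ℕ} {A B : (ℕ → ℕ) → Prop} (hA : OInv m A) (hB : OInv j B) :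
    cnt (m + j) (fun f => A f ∧ B (fun i => f (m + i))) * (m.factorial * j.factorial) =
      (m + j).factorial * (cnt m A * cnt j B) := by
  set N := cnt (m + j) (fun f => A f ∧ B (fun i => f (m + i))) with hN
  have h1 : ∀ g : Equiv.Perm (Fin m), ∀ h : Equiv.Perm (Fin j),
      N = ∑ π : Equiv.Perm (Fin (m + j)),
        (if A (extF (fun i => (π (Fin.castAdd j (g i)) : ℕ))) then (1 : ℚ) else 0) *
        (if B (extF (fun i => (π (Fin.natAdd m (h i)) : ℕ))) then (1 : ℚ) else 0) := by
    intro g h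
    rw [hN, cnt, ← Equiv.sum_comp (Equiv.mulRight (blk g h))]
    refine Finset.sum_congr rfl fun π _ => ?_
    have e1 : A (permF (Equiv.mulRight (blk g h) π)) ↔
        A (extF (fun i => (π (Fin.castAdd j (g i)) : ℕ))) := by
      apply oinv_congr hA
      intro i hi
      have : i < m + j := by omega
      simp only [permF, extF, hi, this, dif_pos, Equiv.coe_mulRight, Equiv.Perm.mul_apply]
      rw [← blk_left g h]; rfl
    have e2 : B (fun i => permF (Equiv.mulRight (blk g h) π) (m + i)) ↔
        B (extF (fun i => (π (Fin.natAdd m (h i)) : ℕ))) := by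
      apply oinv_congr hB
      intro i hi
      have : m + i < m + j := by omega
      simp only [permF, extF, hi, this, dif_pos, Equiv.coe_mulRight, Equiv.Perm.mul_apply]
      rw [← blk_right g h]; rfl
    simp only [e1, e2]
    split_ifs <;> simp_all
  have h2 : ∑ _g : Equiv.Perm (Fin m), ∑ _h : Equiv.Perm (Fin j), N =
      N * (m.factorial * j.factorial) := by
    simp [Fintype.card_perm]; ring
  rw [← h2]
  calc _ = ∑ g : Equiv.Perm (Fin m), ∑ h : Equiv.Perm (Fin j), ∑ π : Equiv.Perm (Fin (m + j)),
        (if A (extF (fun i => (π (Fin.castAdd j (g i)) : ℕ))) then (1 : ℚ) else 0) *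
        (if B (extF (fun i => (π (Fin.natAdd m (h i)) : ℕ))) then (1 : ℚ) else 0) :=
        Finset.sum_congr rfl fun g _ => Finset.sum_congr rfl fun h _ => h1 g h
    _ = ∑ π : Equiv.Perm (Fin (m + j)), (∑ g : Equiv.Perm (Fin m),
        (if A (extF (fun i => (π (Fin.castAdd j (g i)) : ℕ))) then (1 : ℚ) else 0)) *
        (∑ h : Equiv.Perm (Fin j),
        (if B (extF (fun i => (π (Fin.natAdd m (h i)) : ℕ))) then (1 : ℚ) else 0)) := by
        simp_rw [Finset.sum_mul_sum]
        symm
        rw [Finset.sum_comm]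
        exact Finset.sum_congr rfl fun g _ => Finset.sum_comm
    _ = ∑ π : Equiv.Perm (Fin (m + j)), cnt m A * cnt j B := by
        refine Finset.sum_congr rfl fun π _ => ?_
        rw [cnt_inj hA (fun i => (π (Fin.castAdd j i) : ℕ)), cnt_inj hB (fun i => (π (Fin.natAdd m i) : ℕ))]
        · intro x y hxy
          simpa [Fin.ext_iff] using π.injective (Fin.ext hxy)
        · intro x y hxy
          simpa [Fin.ext_iff] using π.injective (Fin.ext hxy)
    _ = _ := by simp [Fintype.card_perm]

lemma pr_mul {m j : ℕ} {A B : (ℕ → ℕ) → Prop} (hA : OInv m A) (hB : OInv j B) :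
    pr (m + j) (fun f => A f ∧ B (fun i => f (m + i))) = pr m A * pr j B := by
  have := cnt_mul hA hB
  have h1 := Nat.cast_ne_zero (R := ℚ).2 (Nat.factorial_ne_zero m)
  have h2 := Nat.cast_ne_zero (R := ℚ).2 (Nat.factorial_ne_zero j)
  have h3 := Nat.cast_ne_zero (R := ℚ).2 (Nat.factorial_ne_zero (m+j))
  unfold pr
  field_simp
  linarith

lemma pr_le {n : ℕ} {A B : (ℕ → ℕ) → Prop} (h : ∀ f, A f → B f) : pr n A ≤ pr n B := by
  unfold pr cnt
  gcongr with π
  have := h (permF π)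
  split_ifs <;> simp_all

lemma pr_nonneg {n : ℕ} {A : (ℕ → ℕ) → Prop} : 0 ≤ pr n A := by
  unfold pr cnt; positivity

lemma pr_congr {n : ℕ} {A B : (ℕ → ℕ) → Prop} (h : ∀ f, A f ↔ B f) : pr n A = pr n B :=
  le_antisymm (pr_le fun f => (h f).1) (pr_le fun f => (h f).2)

lemma pr_add {n : ℕ} {A B C : (ℕ → ℕ) → Prop} (h : ∀ f, A f ↔ (B f ∨ C f))
    (h' : ∀ f, ¬ (B f ∧ C f)) : pr n A = pr n B + pr n C := by
  unfold pr cnt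
  rw [← add_div, ← Finset.sum_add_distrib]
  congr 1
  refine Finset.sum_congr rfl fun π _ => ?_
  have := h (permF π)
  have := h' (permF π)
  split_ifs <;> simp_all

lemma pr_true {n : ℕ} : pr n (fun _ => True) = 1 := by
  have h1 := Nat.cast_ne_zero (R := ℚ).2 (Nat.factorial_ne_zero n)
  simp [pr, cnt, Fintype.card_perm, h1]


def av (O : (ℕ → ℕ) → Prop) (m : ℕ) (f : ℕ → ℕ) : Prop :=
  ∀ i, i + 4 ≤ m → ¬ O (fun t => f (i + t))

def chain (O : (ℕ → ℕ) → Prop) (k : ℕ) (f : ℕ → ℕ) : Prop :=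
  ∀ r, r < k → O (fun t => f (3 * r + t))

def UU (O : (ℕ → ℕ) → Prop) (m k : ℕ) (f : ℕ → ℕ) : Prop :=
  av O m f ∧ chain O k (fun i => f (m + i))

def TT (O : (ℕ → ℕ) → Prop) (m k : ℕ) (f : ℕ → ℕ) : Prop :=
  av O (m + 1) f ∧ chain O k (fun i => f (m + i))

noncomputable def tt (O : (ℕ → ℕ) → Prop) (m k : ℕ) : ℚ := pr (m + (3 * k + 1)) (TT O m k)

noncomputable def aa (O : (ℕ → ℕ) → Prop) (m : ℕ) : ℚ := pr m (av O m)

def NonOv (O : (ℕ → ℕ) → Prop) : Prop :=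
  ∀ f : ℕ → ℕ, O f → ¬ O (fun t => f (1 + t)) ∧ ¬ O (fun t => f (2 + t))

lemma av_oinv {O : (ℕ → ℕ) → Prop} (hO : OInv 4 O) (m : ℕ) : OInv m (av O m) := by
  intro f g h
  unfold av
  refine forall_congr' fun i => ?_
  refine imp_congr_right fun hi => ?_
  rw [hO (fun t => f (i + t)) (fun t => g (i + t))]
  intro a ha b hb
  exact h _ (by omega) _ (by omega)

lemma chain_oinv {O : (ℕ → ℕ) → Prop} (hO : OInv 4 O) (k : ℕ) :
    OInv (3 * k + 1) (chain O k) := by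
  intro f g h
  unfold chain
  refine forall_congr' fun i => ?_
  refine imp_congr_right fun hi => ?_
  rw [hO (fun t => f (3 * i + t)) (fun t => g (3 * i + t))]
  intro a ha b hb
  exact h _ (by omega) _ (by omega)

lemma pr_UU {O : (ℕ → ℕ) → Prop} (hO : OInv 4 O) (m k : ℕ) :
    pr (m + (3 * k + 1)) (UU O m k) = aa O m * pr (3 * k + 1) (chain O k) :=
  pr_mul (av_oinv hO m) (chain_oinv hO k)

lemma UU_small {O : (ℕ → ℕ) → Prop} (hO : OInv 4 O) (m k : ℕ) (hm : m < 3) :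
    aa O m * pr (3 * k + 1) (chain O k) = tt O m k := by
  rw [← pr_UU hO]
  refine pr_congr fun f => ?_
  unfold UU TT av
  refine and_congr_left fun _ => ⟨fun _ i hi => by omega, fun _ i hi => by omega⟩

lemma UU_step {O : (ℕ → ℕ) → Prop} (hO : OInv 4 O) (hN : NonOv O) (m k : ℕ) :
    aa O (m + 3) * pr (3 * k + 1) (chain O k) = tt O (m + 3) k + tt O m (k + 1) := by
  rw [← pr_UU hO]
  unfold tt
  rw [show m + (3 * (k + 1) + 1) = m + 3 + (3 * k + 1) by ring]
  have key : ∀ f : ℕ → ℕ, chain O (k + 1) (fun i => f (m + i)) ↔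
      O (fun t => f (m + t)) ∧ chain O k (fun i => f (m + 3 + i)) := by
    intro f
    unfold chain
    constructor
    · intro h
      refine ⟨by simpa using h 0 (by omega), fun r hr => ?_⟩
      have := h (r + 1) (by omega)
      simpa [mul_add, add_assoc, add_left_comm, add_comm] using this
    · rintro ⟨h0, h⟩ r hr
      rcases r with _ | r
      · simpa using h0
      · have := h r (by omega)
        simpa [mul_add, add_assoc, add_left_comm, add_comm] using this
  apply pr_add
  · intro f
    unfold UU TT
    rw [key]
    constructor
    · rintro ⟨h1, h2⟩
      by_cases h : O (fun t => f (m + t))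
      · exact Or.inr ⟨fun i hi => h1 i (by omega), h, h2⟩
      · refine Or.inl ⟨fun i hi => ?_, h2⟩
        rcases Nat.lt_or_ge i m with h' | h'
        · exact h1 i (by omega)
        · rwa [show i = m by omega]
    · rintro (⟨h1, h2⟩ | ⟨h1, h2, h3⟩)
      · exact ⟨fun i hi => h1 i (by omega), h2⟩
      · refine ⟨fun i hi ho => ?_, h3⟩
        by_cases hi' : i + 4 ≤ m + 1
        · exact h1 i hi' ho
        have := hN _ ho
        rcases (show m = i + 1 ∨ m = i + 2 by omega) with rfl | rfl
        · exact this.1 (by simpa [add_assoc] using h2)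
        · exact this.2 (by simpa [add_assoc] using h2)
  · intro f
    unfold TT
    rw [key]
    rintro ⟨⟨h1, -⟩, -, h2, -⟩
    exact h1 m (by omega) h2

lemma tt_zero {O : (ℕ → ℕ) → Prop} (m : ℕ) : tt O m 0 = aa O (m + 1) := by
  unfold tt aa
  simp only [Nat.mul_zero, Nat.zero_add]
  exact pr_congr fun f => by simp [TT, chain]

lemma tt_nonneg {O : (ℕ → ℕ) → Prop} (m k : ℕ) : 0 ≤ tt O m k := pr_nonneg
lemma aa_nonneg {O : (ℕ → ℕ) → Prop} (m : ℕ) : 0 ≤ aa O m := pr_nonneg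

lemma chain_zero {O : (ℕ → ℕ) → Prop} : pr (3 * 0 + 1) (chain O 0) = 1 := by
  rw [← pr_true (n := 3 * 0 + 1)]
  exact pr_congr fun f => by simp [chain]

lemma aa_small {O : (ℕ → ℕ) → Prop} (m : ℕ) (hm : m < 4) : aa O m = 1 := by
  rw [← pr_true (n := m)]
  exact pr_congr fun f => by simp only [av, iff_true]; intro i hi; omega

lemma aa_rec {O : (ℕ → ℕ) → Prop} (hO : OInv 4 O) (hN : NonOv O) (m : ℕ) :
    aa O (m + 4) = aa O (m + 3) - tt O m 1 := by
  have := UU_step hO hN m 0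
  rw [chain_zero, tt_zero] at this
  linarith

lemma tt_le {O : (ℕ → ℕ) → Prop} (hO : OInv 4 O) (m k : ℕ) :
    tt O m k ≤ aa O m * pr (3 * k + 1) (chain O k) := by
  rw [← pr_UU hO]
  refine pr_le fun f h => ⟨fun i hi => h.1 i (by omega), h.2⟩

/-- ratio bound -/
lemma aa_ratio {O : (ℕ → ℕ) → Prop} (hO : OInv 4 O) (hN : NonOv O)
    (h1 : pr 4 (chain O 1) = 1 / 24) (n : ℕ) : 9 / 10 * aa O n ≤ aa O (n + 1) := by
  induction n using Nat.strong_induction_on with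
  | _ n ih =>
    rcases Nat.lt_or_ge n 3 with h | h
    · rw [aa_small n (by omega), aa_small (n + 1) (by omega)]; norm_num
    · obtain ⟨m, rfl⟩ := Nat.exists_eq_add_of_le' h
      have a1 := ih m (by omega)
      have a2 := ih (m + 1) (by omega)
      have a3 := ih (m + 2) (by omega)
      have := aa_rec hO hN m
      have h2 := tt_le hO m 1
      simp only [Nat.mul_one] at h2
      rw [h1] at h2
      have := aa_nonneg (O := O) (m + 3)
      rw [show m + 3 + 1 = m + 4 by ring]
      simp only [add_assoc] at *
      norm_num at *
      linarith

lemma aa_pos {O : (ℕ → ℕ) → Prop} (hO : OInv 4 O) (hN : NonOv O)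
    (h1 : pr 4 (chain O 1) = 1 / 24) (n : ℕ) : 0 < aa O n := by
  induction n with
  | zero => rw [aa_small 0 (by omega)]; norm_num
  | succ n ih => have := aa_ratio hO hN h1 n; linarith

def O3 (f : ℕ → ℕ) : Prop := f 2 < f 0 ∧ f 0 < f 1

lemma O3_oinv : OInv 3 O3 := by
  intro f g h
  unfold O3
  rw [h 2 (by omega) 0 (by omega), h 0 (by omega) 1 (by omega)]

lemma tt3_le {O : (ℕ → ℕ) → Prop} (hO : OInv 4 O)
    (h3 : ∀ f, O f → O3 (fun i => f (1 + i))) (m : ℕ) :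
    tt O m 3 ≤ aa O m * pr 7 (chain O 2) * pr 3 O3 := by
  unfold aa
  rw [mul_assoc, ← pr_mul (chain_oinv hO 2) O3_oinv, ← pr_mul (av_oinv hO m)]
  · refine pr_le fun f h => ⟨fun i hi => h.1 i (by omega), fun r hr => h.2 r (by omega), ?_⟩
    have := h3 _ (h.2 2 (by omega))
    simpa [← add_assoc] using this
  · intro f g h
    have := chain_oinv hO 2 f g (fun i hi j hj => h i (by omega) j (by omega))
    show (_ ∧ _) ↔ (_ ∧ _)
    rw [this, O3_oinv _ (fun i => g (3 * 2 + 1 + i))]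
    exact fun i hi j hj => h _ (by omega) _ (by omega)

lemma tt2_ge {O : (ℕ → ℕ) → Prop} (hO : OInv 4 O) (hN : NonOv O)
    (h1 : pr 4 (chain O 1) = 1 / 24) (h3 : ∀ f, O f → O3 (fun i => f (1 + i)))
    (h6 : pr 3 O3 ≤ 1 / 6) (n : ℕ) :
    7 / 10 * (aa O n * pr 7 (chain O 2)) ≤ tt O n 2 := by
  have hC : 0 ≤ pr 7 (chain O 2) := pr_nonneg
  have han := aa_nonneg (O := O) n
  rcases Nat.lt_or_ge n 3 with h | h
  · have := UU_small hO n 2 h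
    norm_num at this
    rw [← this]
    nlinarith [mul_nonneg han hC]
  · obtain ⟨m, rfl⟩ := Nat.exists_eq_add_of_le' h
    have e := UU_step hO hN m 2
    have t := tt3_le hO h3 m
    norm_num at e
    have a1 := aa_ratio hO hN h1 m
    have a2 := aa_ratio hO hN h1 (m + 1)
    have a3 := aa_ratio hO hN h1 (m + 2)
    norm_num [add_assoc] at a1 a2 a3
    have a4 : aa O m ≤ 1000 / 729 * aa O (m + 3) := by linarith
    have b1 : aa O m * pr 7 (chain O 2) * pr 3 O3 ≤ aa O m * pr 7 (chain O 2) * (1 / 6) :=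
      mul_le_mul_of_nonneg_left h6 (mul_nonneg (aa_nonneg m) hC)
    have b2 := mul_le_mul_of_nonneg_right a4 hC
    have := mul_nonneg han hC
    linarith

theorem main_cmp {O Q : (ℕ → ℕ) → Prop} (hO : OInv 4 O) (hN : NonOv O)
    (h1 : pr 4 (chain O 1) = 1 / 24) (h3 : ∀ f, O f → O3 (fun i => f (1 + i)))
    (h6 : pr 3 O3 ≤ 1 / 6) (hQ : OInv 4 Q) (hNQ : NonOv Q) (h1Q : pr 4 (chain Q 1) = 1 / 24)
    (hC : 6 / 5040 ≤ pr 7 (chain O 2)) (hD : pr 7 (chain Q 2) ≤ 4 / 5040) (n : ℕ) (hn : 7 ≤ n) :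
    aa Q n < aa O n := by
  have id4 : ∀ m, m < 3 → aa O (m + 4) = aa Q (m + 4) := by
    have t : ∀ m, m < 3 → tt O m 1 = 1 / 24 ∧ tt Q m 1 = 1 / 24 := by
      intro m hm
      have e1 := UU_small hO m 1 hm
      have e2 := UU_small hQ m 1 hm
      simp only [Nat.mul_one] at e1 e2
      rw [h1, aa_small m (by omega)] at e1
      rw [h1Q, aa_small m (by omega)] at e2
      constructor <;> linarith
    have t0 := t 0 (by omega)
    have t1 := t 1 (by omega)
    have t2 := t 2 (by omega)
    have r0 := aa_rec hO hN 0
    have s0 := aa_rec hQ hNQ 0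
    have r1 := aa_rec hO hN 1
    have s1 := aa_rec hQ hNQ 1
    have r2 := aa_rec hO hN 2
    have s2 := aa_rec hQ hNQ 2
    simp only [Nat.reduceAdd] at r0 s0 r1 s1 r2 s2
    rw [aa_small 3 (by omega)] at r0 s0
    intro m hm
    interval_cases m <;> simp only [Nat.reduceAdd] <;> linarith
  have id7 : ∀ m, aa O (m + 7) - aa Q (m + 7) = (aa O (m + 6) - aa Q (m + 6))
      - (aa O (m + 3) - aa Q (m + 3)) / 24 + (tt O m 2 - tt Q m 2) := by
    intro m
    have e1 := aa_rec hO hN (m + 3)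
    have e2 := aa_rec hQ hNQ (m + 3)
    have e3 := UU_step hO hN m 1
    have e4 := UU_step hQ hNQ m 1
    norm_num [add_assoc, h1, h1Q] at e1 e2 e3 e4
    linarith
  have pos : ∀ m, aa Q m ≤ aa O m → 0 < tt O m 2 - tt Q m 2 := by
    intro m hm
    have t1 := tt2_ge hO hN h1 h3 h6 m
    have t2 := tt_le hQ m 2
    norm_num at t2
    have p := aa_pos hO hN h1 m
    have q := aa_nonneg (O := Q) m
    have u1 := mul_le_mul_of_nonneg_left hC p.le
    have u2 := mul_le_mul_of_nonneg_left hD q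
    linarith
  have main : ∀ n, aa Q n ≤ aa O n ∧
      9 / 10 * (aa O n - aa Q n) ≤ aa O (n + 1) - aa Q (n + 1) := by
    intro n
    induction n using Nat.strong_induction_on with
    | _ n ih =>
      have hn : aa Q n ≤ aa O n := by
        rcases n with _ | n
        · simp [aa_small]
        · have := ih n (by omega); linarith
      refine ⟨hn, ?_⟩
      have small : ∀ k, k < 7 → aa O k = aa Q k := by
        intro k hk
        rcases Nat.lt_or_ge k 4 with h | h
        · rw [aa_small k h, aa_small k h]
        · obtain ⟨m, rfl⟩ := Nat.exists_eq_add_of_le' h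
          exact id4 m (by omega)
      rcases Nat.lt_or_ge n 6 with h | h
      · rw [small n (by omega), small (n + 1) (by omega)]; simp
      · obtain ⟨m, rfl⟩ := Nat.exists_eq_add_of_le' h
        have a0 := pos m (ih m (by omega)).1
        have a3 := (ih (m + 3) (by omega))
        have a4 := (ih (m + 4) (by omega))
        have a5 := (ih (m + 5) (by omega))
        have := id7 m
        norm_num [add_assoc] at *
        linarith
  obtain ⟨m, rfl⟩ := Nat.exists_eq_add_of_le' hn
  have a0 := pos m (main m).1
  have a3 := main (m + 3)
  have a4 := main (m + 4)
  have a5 := main (m + 5)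
  have a6 := main (m + 6)
  have := id7 m
  norm_num [add_assoc] at *
  linarith


def O1 (f : ℕ → ℕ) : Prop := f 0 < f 3 ∧ f 3 < f 1 ∧ f 1 < f 2
def O2 (f : ℕ → ℕ) : Prop := f 0 < f 1 ∧ f 1 < f 3 ∧ f 3 < f 2

lemma O1_oinv : OInv 4 O1 := by
  intro f g h
  unfold O1
  rw [h 0 (by omega) 3 (by omega), h 3 (by omega) 1 (by omega), h 1 (by omega) 2 (by omega)]

lemma O2_oinv : OInv 4 O2 := by
  intro f g h
  unfold O2
  rw [h 0 (by omega) 1 (by omega), h 1 (by omega) 3 (by omega), h 3 (by omega) 2 (by omega)]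

lemma O1_nonov : NonOv O1 := by
  intro f h
  unfold O1 at *
  norm_num at *
  omega

lemma O2_nonov : NonOv O2 := by
  intro f h
  unfold O2 at *
  norm_num at *
  omega

lemma chain_one (O : (ℕ → ℕ) → Prop) (f) : chain O 1 f ↔ O f := by
  simp [chain]

lemma chain_two (O : (ℕ → ℕ) → Prop) (f) : chain O 2 f ↔ O f ∧ O (fun t => f (3 + t)) := by
  constructor
  · intro h; exact ⟨by simpa using h 0 (by omega), by simpa using h 1 (by omega)⟩
  · rintro ⟨h0, h1⟩ r hr
    interval_cases r <;> simpa

open Classical in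
lemma cnt_card (n : ℕ) (A : (ℕ → ℕ) → Prop) (p : Equiv.Perm (Fin n) → Prop) [DecidablePred p]
    (h : ∀ π, A (permF π) ↔ p π) :
    cnt n A = ((Finset.univ.filter p).card : ℚ) := by
  unfold cnt
  rw [Finset.card_filter]
  push_cast
  exact Finset.sum_congr rfl fun π _ => by simp only [h]

lemma pr_O1 : pr 4 (chain O1 1) = 1 / 24 := by
  unfold pr
  rw [cnt_card 4 _ (fun π => π 0 < π 3 ∧ π 3 < π 1 ∧ π 1 < π 2)]
  · rw [show (Finset.univ.filter (fun π : Equiv.Perm (Fin 4) => π 0 < π 3 ∧ π 3 < π 1 ∧ π 1 < π 2)).card = 1 by decide +kernel]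
    norm_num [Nat.factorial]
  · intro π; rw [chain_one]; simp [O1, permF, extF]

lemma pr_O2 : pr 4 (chain O2 1) = 1 / 24 := by
  unfold pr
  rw [cnt_card 4 _ (fun π => π 0 < π 1 ∧ π 1 < π 3 ∧ π 3 < π 2)]
  · rw [show (Finset.univ.filter (fun π : Equiv.Perm (Fin 4) => π 0 < π 1 ∧ π 1 < π 3 ∧ π 3 < π 2)).card = 1 by decide +kernel]
    norm_num [Nat.factorial]
  · intro π; rw [chain_one]; simp [O2, permF, extF]

lemma pr_O3 : pr 3 O3 ≤ 1 / 6 := by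
  unfold pr
  rw [cnt_card 3 _ (fun π => π 2 < π 0 ∧ π 0 < π 1)]
  · rw [show (Finset.univ.filter (fun π : Equiv.Perm (Fin 3) => π 2 < π 0 ∧ π 0 < π 1)).card = 1 by decide +kernel]
    norm_num [Nat.factorial]
  · intro π; simp [O3, permF, extF]

def wC : Fin 6 → Fin 7 → Fin 7 :=
  ![![0, 2, 3, 1, 5, 6, 4], ![0, 2, 4, 1, 5, 6, 3], ![0, 2, 5, 1, 4, 6, 3],
    ![0, 2, 6, 1, 4, 5, 3], ![0, 3, 4, 1, 5, 6, 2], ![0, 3, 5, 1, 4, 6, 2]]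

lemma wC_inj : ∀ a, Function.Injective (wC a) := by decide

noncomputable def pC (a : Fin 6) : Equiv.Perm (Fin 7) :=
  Equiv.ofBijective (wC a) (Finite.injective_iff_bijective.1 (wC_inj a))

lemma pC_inj : Function.Injective pC := by
  intro a b h
  have h1 : wC a 1 = wC b 1 := congrArg (fun e : Equiv.Perm (Fin 7) => e 1) h
  have h2 : wC a 2 = wC b 2 := congrArg (fun e : Equiv.Perm (Fin 7) => e 2) h
  revert a b
  have : ∀ a b, wC a 1 = wC b 1 → wC a 2 = wC b 2 → a = b := by decide
  exact fun a b _ => this a b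

lemma pr_C : 6 / 5040 ≤ pr 7 (chain O1 2) := by
  unfold pr
  rw [cnt_card 7 _ (fun π => (π 0 < π 3 ∧ π 3 < π 1 ∧ π 1 < π 2) ∧
    (π 3 < π 6 ∧ π 6 < π 4 ∧ π 4 < π 5))]
  · have : 6 ≤ (Finset.univ.filter (fun π : Equiv.Perm (Fin 7) =>
        (π 0 < π 3 ∧ π 3 < π 1 ∧ π 1 < π 2) ∧ (π 3 < π 6 ∧ π 6 < π 4 ∧ π 4 < π 5))).card := by
      have h := Finset.card_image_of_injective (Finset.univ : Finset (Fin 6)) pC_inj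
      rw [Finset.card_univ, Fintype.card_fin] at h
      refine h.symm.le.trans (Finset.card_le_card ?_)
      intro π hπ
      obtain ⟨a, -, rfl⟩ := Finset.mem_image.1 hπ
      have : ∀ a, (wC a 0 < wC a 3 ∧ wC a 3 < wC a 1 ∧ wC a 1 < wC a 2) ∧
        (wC a 3 < wC a 6 ∧ wC a 6 < wC a 4 ∧ wC a 4 < wC a 5) := by decide
      exact Finset.mem_filter.2 ⟨Finset.mem_univ _, this a⟩
    rw [show ((7 : ℕ).factorial : ℚ) = 5040 by norm_num [Nat.factorial]]
    gcongr
    exact_mod_cast this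
  · intro π; rw [chain_two]; simp [O1, permF, extF]

lemma uniqD (x0 x1 v x3 x4 x5 x6 : ℕ) (h : (x0 < x1 ∧ x1 < x3 ∧ x3 < v) ∧
    (x3 < x4 ∧ x4 < x6 ∧ x6 < x5)) (h5 : x5 < 7) (hv : v < 7) (h4 : x4 ≠ v) (h6 : x6 ≠ v)
    (h5' : x5 ≠ v) : x0 = 0 ∧ x1 = 1 ∧ x3 = 2 ∧ x4 = (if v = 3 then 4 else 3) ∧
      x6 = (if v ≤ 4 then 5 else 4) ∧ x5 = (if v ≤ 5 then 6 else 5) := by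
  split_ifs <;> omega

lemma pr_D : pr 7 (chain O2 2) ≤ 4 / 5040 := by
  unfold pr
  rw [cnt_card 7 _ (fun π => (π 0 < π 1 ∧ π 1 < π 3 ∧ π 3 < π 2) ∧
    (π 3 < π 4 ∧ π 4 < π 6 ∧ π 6 < π 5))]
  · have : (Finset.univ.filter (fun π : Equiv.Perm (Fin 7) =>
        (π 0 < π 1 ∧ π 1 < π 3 ∧ π 3 < π 2) ∧ (π 3 < π 4 ∧ π 4 < π 6 ∧ π 6 < π 5))).card ≤
        ({3, 4, 5, 6} : Finset (Fin 7)).card := by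
      apply Finset.card_le_card_of_injOn (fun π => π 2)
      · intro π hπ
        have h := (Finset.mem_filter.1 hπ).2
        have : ∀ w : Fin 7, 3 ≤ (w : ℕ) → w ∈ ({3, 4, 5, 6} : Finset (Fin 7)) := by decide
        refine this _ ?_
        show 3 ≤ (π 2 : ℕ)
        simp only [Fin.lt_def] at h
        omega
      · intro π hπ ρ hρ e
        have h := (Finset.mem_filter.1 hπ).2
        have h' := (Finset.mem_filter.1 hρ).2
        have ne : ∀ (τ : Equiv.Perm (Fin 7)) (a b : Fin 7), a ≠ b → (τ a : ℕ) ≠ τ b :=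
          fun τ a b hab hh => hab (τ.injective (Fin.ext hh))
        have u := uniqD _ _ _ _ _ _ _ h (π 5).isLt (π 2).isLt (ne π 4 2 (by decide))
          (ne π 6 2 (by decide)) (ne π 5 2 (by decide))
        have u' := uniqD _ _ _ _ _ _ _ h' (ρ 5).isLt (ρ 2).isLt (ne ρ 4 2 (by decide))
          (ne ρ 6 2 (by decide)) (ne ρ 5 2 (by decide))
        have e : π 2 = ρ 2 := e
        rw [← e] at u'
        obtain ⟨a0, a1, a3, a4, a6, a5⟩ := u
        obtain ⟨b0, b1, b3, b4, b6, b5⟩ := u'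
        apply Equiv.ext
        intro i
        fin_cases i
        · exact Fin.ext (a0.trans b0.symm)
        · exact Fin.ext (a1.trans b1.symm)
        · exact e
        · exact Fin.ext (a3.trans b3.symm)
        · exact Fin.ext (a4.trans b4.symm)
        · exact Fin.ext (a5.trans b5.symm)
        · exact Fin.ext (a6.trans b6.symm)
    rw [show ({3, 4, 5, 6} : Finset (Fin 7)).card = 4 by decide] at this
    rw [show ((7 : ℕ).factorial : ℚ) = 5040 by norm_num [Nat.factorial]]
    gcongr
    exact_mod_cast this
  · intro π; rw [chain_two]; simp [O2, permF, extF]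

lemma av_bridge {n : ℕ} (σ : Equiv.Perm (Fin 4)) (O : (ℕ → ℕ) → Prop)
    (h : ∀ (π : Equiv.Perm (Fin n)) i, occursAt σ π i ↔ i + 4 ≤ n ∧ O (fun t => permF π (i + t))) :
    (avoiders n σ : ℚ) = aa O n * n.factorial := by
  classical
  have h1 := Nat.cast_ne_zero (R := ℚ).2 (Nat.factorial_ne_zero n)
  unfold aa pr avoiders
  rw [div_mul_cancel₀ _ h1, cnt_card n _ (fun π => ∀ i : ℕ, ¬ occursAt σ π i),
    Nat.card_eq_fintype_card, Fintype.card_subtype]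
  intro π
  simp only [h, av, not_and]

lemma occ1 {n : ℕ} (π : Equiv.Perm (Fin n)) (i : ℕ) :
    occursAt p1342 π i ↔ i + 4 ≤ n ∧ O1 (fun t => permF π (i + t)) := by
  unfold occursAt
  rw [← exists_prop]
  refine exists_congr fun h => ?_
  have b0 : i < n := by omega
  have b1 : i + 1 < n := by omega
  have b2 : i + 2 < n := by omega
  have b3 : i + 3 < n := by omega
  simp only [O1, permF, extF, Nat.add_zero, b0, b1, b2, b3, dif_pos]
  constructor
  · intro H
    exact ⟨(H 0 3).1 (by decide), (H 3 1).1 (by decide), (H 1 2).1 (by decide)⟩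
  · rintro ⟨h1, h2, h3⟩ j k
    fin_cases j <;> fin_cases k <;> simp [p1342] <;> omega

lemma occ2 {n : ℕ} (π : Equiv.Perm (Fin n)) (i : ℕ) :
    occursAt p1243 π i ↔ i + 4 ≤ n ∧ O2 (fun t => permF π (i + t)) := by
  unfold occursAt
  rw [← exists_prop]
  refine exists_congr fun h => ?_
  have b0 : i < n := by omega
  have b1 : i + 1 < n := by omega
  have b2 : i + 2 < n := by omega
  have b3 : i + 3 < n := by omega
  simp only [O2, permF, extF, Nat.add_zero, b0, b1, b2, b3, dif_pos]
  constructor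
  · intro H
    exact ⟨(H 0 1).1 (by decide), (H 1 3).1 (by decide), (H 3 2).1 (by decide)⟩
  · rintro ⟨h1, h2, h3⟩ j k
    fin_cases j <;> fin_cases k <;> simp [p1243] <;> omega

end CP

/-- For all `n ≥ 7`, `α_n(1342) > α_n(1243)`. -/
theorem avoiders_1342_gt_1243 : ∀ n : ℕ, 7 ≤ n → avoiders n p1243 < avoiders n p1342 := by
  intro n hn
  have key := main_cmp O1_oinv O1_nonov pr_O1
    (fun f h => by unfold O1 at h; unfold O3; norm_num; omega) pr_O3
    O2_oinv O2_nonov pr_O2 pr_C pr_D n hn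
  have e1 := av_bridge (n := n) p1342 O1 occ1
  have e2 := av_bridge (n := n) p1243 O2 occ2
  have hp : (0 : ℚ) < n.factorial := by exact_mod_cast Nat.factorial_pos n
  have := mul_lt_mul_of_pos_right key hp
  rw [← e1, ← e2] at this
  exact_mod_cast this
end

section
/- For every pattern σ ∈ S_m with m ≥ 3, there exist constants 0 < c < d < 1 and N such that c^n · n! ≤ α_n(σ) ≤ d^n · n! for all n ≥ N. -/
open Classical in
theorem ag_lower_count {n : ℕ} (g : Fin n → Fin 3) :
    ∃ A : Finset (Equiv.Perm (Fin n)), n.factorial ≤ 3 ^ n * A.card ∧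
      ∀ π ∈ A, ∀ i j, g i < g j → π i < π j := by
  set s := Tuple.sort g with hs
  have hmono : Monotone (g ∘ s) := Tuple.monotone_sort g
  refine ⟨Finset.univ.filter (fun π => ∀ i, g (s (π i)) = g i), ?_, ?_⟩
  · set A := Finset.univ.filter (fun π : Equiv.Perm (Fin n) => ∀ i, g (s (π i)) = g i) with hA
    have h := Finset.card_le_mul_card_image_of_maps_to (s := (Finset.univ : Finset (Equiv.Perm (Fin n))))
      (t := (Finset.univ : Finset (Fin n → Fin 3))) (f := fun ρ : Equiv.Perm (Fin n) => g ∘ ρ)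
      (fun _ _ => Finset.mem_univ _) A.card ?_
    · simp only [Finset.card_univ, Fintype.card_perm, Fintype.card_fin, Fintype.card_pi,
        Finset.prod_const] at h
      rw [mul_comm]; exact h
    · intro b _
      by_cases hb : ∃ ρ₀ : Equiv.Perm (Fin n), g ∘ ρ₀ = b
      · obtain ⟨ρ₀, rfl⟩ := hb
        refine Finset.card_le_card_of_injOn (fun ρ => s⁻¹ * (ρ * ρ₀⁻¹)) ?_ ?_
        · intro ρ hρ
          simp only [Finset.coe_filter, Finset.mem_univ, true_and, Set.mem_ofPred_eq] at hρ
          simp only [hA, Finset.coe_filter, Finset.mem_univ, true_and, Set.mem_ofPred_eq]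
          intro i
          have := congrFun hρ (ρ₀⁻¹ i)
          simpa using this
        · intro a _ c _ hac
          simpa using hac
      · rw [Finset.card_eq_zero.2]
        · exact Nat.zero_le _
        · rw [Finset.filter_eq_empty_iff]
          intro ρ _ h
          exact hb ⟨ρ, h⟩
  · intro π hπ i j hij
    simp only [Finset.mem_filter, Finset.mem_univ, true_and] at hπ
    by_contra hlt
    have := hmono (not_lt.1 hlt)
    simp only [Function.comp_apply, hπ] at this
    exact absurd hij (not_lt.2 this)

theorem ag_lower {m : ℕ} (hm : 3 ≤ m) (σ : Equiv.Perm (Fin m)) (n : ℕ) :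
    n.factorial ≤ 3 ^ n * avoiders n σ := by
  classical
  set a : Fin m := ⟨0, by omega⟩ with ha
  set b : Fin m := ⟨1, by omega⟩ with hb
  set c : Fin m := ⟨2, by omega⟩ with hc
  have hab : σ a ≠ σ b := fun h => by simpa [ha, hb] using σ.injective h
  have hac : σ a ≠ σ c := fun h => by simpa [ha, hc] using σ.injective h
  have hbc : σ b ≠ σ c := fun h => by simpa [hc, hb] using σ.injective h
  have key : ∃ g : Fin n → Fin 3, ∀ π : Equiv.Perm (Fin n),
      (∀ i j, g i < g j → π i < π j) → ∀ i, ¬ occursAt σ π i := by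
    by_cases hev : (σ a < σ b ∧ σ b < σ c) ∨ (σ b < σ c ∧ σ c < σ a) ∨ (σ c < σ a ∧ σ a < σ b)
    · refine ⟨fun i => ⟨2 - i.1 % 3, by omega⟩, ?_⟩
      rintro π hπ i ⟨hi, h⟩
      have h1 := fun x y => (h x y).2 ∘ (hπ _ _)
      simp only [Fin.lt_def] at h1 hev
      have e1 := h1 a b
      have e2 := h1 b a
      have e3 := h1 a c
      have e4 := h1 c a
      have e5 := h1 b c
      have e6 := h1 c b
      simp only [ha, hb, hc] at e1 e2 e3 e4 e5 e6 hev
      omega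
    · refine ⟨fun i => ⟨i.1 % 3, by omega⟩, ?_⟩
      rintro π hπ i ⟨hi, h⟩
      have h1 := fun x y => (h x y).2 ∘ (hπ _ _)
      simp only [Fin.lt_def] at h1 hev
      have e1 := h1 a b
      have e2 := h1 b a
      have e3 := h1 a c
      have e4 := h1 c a
      have e5 := h1 b c
      have e6 := h1 c b
      simp only [ha, hb, hc] at e1 e2 e3 e4 e5 e6 hev
      omega
  obtain ⟨g, hg⟩ := key
  obtain ⟨A, hA, hA'⟩ := ag_lower_count g
  refine hA.trans (Nat.mul_le_mul_left _ ?_)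
  rw [avoiders, Nat.card_eq_fintype_card, Fintype.card_subtype]
  refine Finset.card_le_card ?_
  intro π hπ
  simp only [Finset.mem_filter, Finset.mem_univ, true_and]
  exact hg π (hA' π hπ)

theorem ag_upper {m : ℕ} (σ : Equiv.Perm (Fin m)) (n k : ℕ) (hk : k * m ≤ n) :
    m.factorial ^ k * avoiders n σ ≤ n.factorial * (m.factorial - 1) ^ k := by
  classical
  have hlt : ∀ (b : Fin k) (j : Fin m), b.1 * m + j.1 < n := by
    intro b j
    have h1 : (b.1 + 1) * m ≤ k * m := Nat.mul_le_mul_right _ b.2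
    have h2 := j.2
    rw [Nat.add_mul] at h1
    omega
  let e : Fin k × Fin m ↪ Fin n :=
    ⟨fun p => ⟨p.1.1 * m + p.2.1, hlt p.1 p.2⟩, by
      rintro ⟨b, j⟩ ⟨b', j'⟩ h
      have h : b.1 * m + j.1 = b'.1 * m + j'.1 := by simpa using h
      have h' : finProdFinEquiv (b, j) = finProdFinEquiv (b', j') := by
        apply Fin.ext
        simp only [finProdFinEquiv_apply_val]
        rw [mul_comm m, mul_comm m]; omega
      exact finProdFinEquiv.injective h'⟩
  let φ : (Fin k → Equiv.Perm (Fin m)) → Equiv.Perm (Fin n) := fun h =>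
    Equiv.Perm.viaFintypeEmbedding (Equiv.prodCongrRight h) e
  have hφ : ∀ h b j, φ h (e (b, j)) = e (b, h b j) := by
    intro h b j
    simp [φ, Equiv.Perm.viaFintypeEmbedding_apply_image]
  set A : Finset (Equiv.Perm (Fin n)) := Finset.univ.filter (fun π => ∀ i, ¬ occursAt σ π i) with hA
  have hAc : avoiders n σ = A.card := by
    rw [avoiders, Nat.card_eq_fintype_card, Fintype.card_subtype]
  have hfib : ∀ π : Equiv.Perm (Fin n),
      (Finset.univ.filter (fun h : Fin k → Equiv.Perm (Fin m) => π * φ h ∈ A)).card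
        ≤ (m.factorial - 1) ^ k := by
    intro π
    let τ : Fin k → Equiv.Perm (Fin m) := fun b => Tuple.sort (fun j => π (e (b, j))) * σ
    have hsub : Finset.univ.filter (fun h : Fin k → Equiv.Perm (Fin m) => π * φ h ∈ A) ⊆
        Fintype.piFinset (fun b => Finset.univ.erase (τ b)) := by
      intro h hh
      simp only [hA, Finset.mem_filter, Finset.mem_univ, true_and] at hh
      simp only [Fintype.mem_piFinset, Finset.mem_erase, Finset.mem_univ, and_true]
      intro b hb
      have hmono := Tuple.monotone_sort (fun j => π (e (b, j)))
      have hsm : StrictMono ((fun j => π (e (b, j))) ∘ Tuple.sort (fun j => π (e (b, j)))) := by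
        refine hmono.strictMono_of_injective ?_
        refine Function.Injective.comp ?_ (Equiv.injective _)
        intro x y hxy
        have := e.injective (π.injective hxy)
        exact (Prod.mk.inj this).2
      refine hh (b.1 * m) ⟨?_, ?_⟩
      · have h1 : (b.1 + 1) * m ≤ k * m := Nat.mul_le_mul_right _ b.2
        rw [Nat.add_mul] at h1
        omega
      · intro x y
        have hx : ∀ x : Fin m, (π * φ h) ⟨b.1 * m + x.1, hlt b x⟩ =
            ((fun j => π (e (b, j))) ∘ Tuple.sort (fun j => π (e (b, j)))) (σ x) := by
          intro x
          have : (⟨b.1 * m + x.1, hlt b x⟩ : Fin n) = e (b, x) := rfl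
          rw [this, Equiv.Perm.mul_apply, hφ, hb]
          rfl
        rw [hx, hx]
        exact hsm.lt_iff_lt.symm
    refine (Finset.card_le_card hsub).trans ?_
    simp [Fintype.card_piFinset, Finset.card_erase_of_mem, Fintype.card_perm]
  have hcount := Finset.sum_card_bipartiteAbove_eq_sum_card_bipartiteBelow
    (s := (Finset.univ : Finset (Equiv.Perm (Fin n))))
    (t := (Finset.univ : Finset (Fin k → Equiv.Perm (Fin m)))) (fun π h => π * φ h ∈ A)
  have hR : ∀ h : Fin k → Equiv.Perm (Fin m),
      (Finset.univ.filter (fun π => π * φ h ∈ A)).card = A.card := by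
    intro h
    refine Finset.card_bij (fun π _ => π * φ h) ?_ ?_ ?_
    · intro π hπ; simpa using hπ
    · intro a _ b _ hab; simpa using hab
    · intro b hb; exact ⟨b * (φ h)⁻¹, by simpa using hb, by simp⟩
  simp only [Finset.bipartiteAbove, Finset.bipartiteBelow, hR] at hcount
  rw [Finset.sum_const] at hcount
  have hle := Finset.sum_le_sum (s := Finset.univ) (fun π _ => hfib π)
  rw [hcount] at hle
  simpa [Fintype.card_perm, hAc] using hle

/-- For every pattern `σ` of length `m ≥ 3` there are constants `0 < c < d < 1` and `N`
with `c^n · n! ≤ α_n(σ) ≤ d^n · n!` for all `n ≥ N`. -/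
theorem avoiders_growth {m : ℕ} (hm : 3 ≤ m) (σ : Equiv.Perm (Fin m)) :
    ∃ c d : ℝ, 0 < c ∧ c < d ∧ d < 1 ∧ ∃ N : ℕ, ∀ n : ℕ, N ≤ n →
      c ^ n * (n.factorial : ℝ) ≤ (avoiders n σ : ℝ) ∧
      (avoiders n σ : ℝ) ≤ d ^ n * (n.factorial : ℝ) := by
  have hF : 2 ≤ m.factorial := le_trans (by omega) (Nat.self_le_factorial m)
  have hF' : (2 : ℝ) ≤ m.factorial := by exact_mod_cast hF
  set F : ℝ := (m.factorial : ℝ) with hFdef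
  set q : ℝ := (F - 1) / F with hq
  have hq0 : 0 < q := div_pos (by linarith) (by linarith)
  have hq1 : q < 1 := by rw [hq, div_lt_one (by linarith)]; linarith
  set d : ℝ := q ^ (((2 * m : ℕ) : ℝ)⁻¹) with hd
  have hd0 : 0 < d := Real.rpow_pos_of_pos hq0 _
  have hd1 : d < 1 := Real.rpow_lt_one hq0.le hq1 (by
    have : 0 < 2 * m := by omega
    positivity)
  have hdq : d ^ (2 * m) = q := Real.rpow_inv_natCast_pow hq0.le (by omega)
  refine ⟨min (1 / 3) (d / 2), d, by positivity, ?_, hd1, m, ?_⟩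
  · exact (min_le_right _ _).trans_lt (by linarith)
  intro n hn
  constructor
  · have h1 : (n.factorial : ℝ) ≤ 3 ^ n * avoiders n σ := by exact_mod_cast ag_lower hm σ n
    calc (min (1 / 3) (d / 2)) ^ n * (n.factorial : ℝ)
        ≤ (1 / 3) ^ n * (3 ^ n * avoiders n σ) := by
          gcongr
          exact min_le_left _ _
      _ = avoiders n σ := by
          rw [← mul_assoc, ← mul_pow]; norm_num
  · have h1 := ag_upper σ n (n / m) (Nat.div_mul_le_self n m)
    have h2 : F ^ (n / m) * avoiders n σ ≤ n.factorial * (F - 1) ^ (n / m) := by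
      have : ((m.factorial - 1 : ℕ) : ℝ) = F - 1 := by
        rw [Nat.cast_sub (by omega)]; simp [hFdef]
      rw [← this, hFdef]
      exact_mod_cast h1
    have hFk : 0 < F ^ (n / m) := by positivity
    have h3 : (avoiders n σ : ℝ) ≤ q ^ (n / m) * n.factorial := by
      rw [hq, div_pow, div_mul_eq_mul_div, le_div_iff₀ hFk]
      linarith
    refine h3.trans ?_
    gcongr
    rw [← hdq, ← pow_mul]
    refine pow_le_pow_of_le_one hd0.le hd1.le ?_
    have h4 : 1 ≤ n / m := (Nat.one_le_div_iff (by omega)).2 hn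
    have h5 := Nat.div_add_mod n m
    have h6 := Nat.mod_lt n (show m > 0 by omega)
    nlinarith
end
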